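/- If N is a power of 2 (N = 2^a with a ≥ 0), then every admissible N-tuple is aperiodic; consequently A_N = 2^{N−1}. -/

import Mathlib

/-- An admissible `N`-tuple: `λ : Fin N → ℕ` with `∑ (λᵢ + 1) = 2N` and every consecutive
sum `∑_{k=i}^{j} (λₖ + 1) ≠ N` for `i ≤ j`. -/
def Admissible (N : ℕ) (lam : Fin N → ℕ) : Prop :=
  (∑ i, (lam i + 1)) = 2 * N ∧
  ∀ i j : Fin N, i ≤ j → (∑ k ∈ Finset.Icc i j, (lam k + 1)) ≠ N

/-- `λ` is `d`-periodic: `λ_{(k+d) mod N} = λ_k` for all `k`. -/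
def IsPeriodic (N d : ℕ) (lam : Fin N → ℕ) : Prop :=
  ∀ k : Fin N, lam ⟨((k : ℕ) + d) % N, Nat.mod_lt _ (Nat.zero_lt_of_lt k.isLt)⟩ = lam k

/-- `λ` is aperiodic: the only `d` with `1 ≤ d ≤ N` for which `λ` is `d`-periodic is
`d = N`. -/
def Aperiodic (N : ℕ) (lam : Fin N → ℕ) : Prop :=
  ∀ d : ℕ, 1 ≤ d → d ≤ N → IsPeriodic N d lam → d = N

/-- `A N` is the number of aperiodic admissible `N`-tuples. -/
noncomputable def numAperiodic (N : ℕ) : ℕ :=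
  Nat.card {lam : Fin N → ℕ // Admissible N lam ∧ Aperiodic N lam}

/-- The `N`-periodic extension of `lam` to the natural numbers. -/
def periodicExt {N : ℕ} [NeZero N] (lam : Fin N → ℕ) (k : ℕ) : ℕ := lam (Fin.ofNat N k)

/-- The sum of the first `n` parts `lam k + 1`, indices being read modulo `N`. -/
def partialSum {N : ℕ} [NeZero N] (lam : Fin N → ℕ) (n : ℕ) : ℕ :=
  ∑ k ∈ Finset.range n, (periodicExt lam k + 1)

section

variable {N : ℕ} [NeZero N] (lam : Fin N → ℕ)

lemma periodicExt_val (i : Fin N) : periodicExt lam i = lam i := by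
  simp [periodicExt]

lemma periodicExt_periodic : Function.Periodic (periodicExt lam) N := by
  intro k
  simp only [periodicExt]
  congr 1
  ext
  simp

lemma IsPeriodic.periodicExt_periodic {lam : Fin N → ℕ} {d : ℕ} (h : IsPeriodic N d lam) :
    Function.Periodic (periodicExt lam) d := by
  intro k
  have hk := h (Fin.ofNat N k)
  simp only [periodicExt]
  rw [← hk]
  congr 1
  ext
  simp

lemma partialSum_zero : partialSum lam 0 = 0 := by simp [partialSum]

lemma partialSum_succ (n : ℕ) :
    partialSum lam (n + 1) = partialSum lam n + (periodicExt lam n + 1) :=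
  Finset.sum_range_succ _ _

lemma partialSum_strictMono : StrictMono (partialSum lam) :=
  strictMono_nat_of_lt_succ fun n => by rw [partialSum_succ]; omega

lemma sum_univ_eq_partialSum : ∑ i, (lam i + 1) = partialSum lam N := by
  rw [partialSum, ← Fin.sum_univ_eq_sum_range (fun k => periodicExt lam k + 1)]
  simp only [periodicExt_val]

lemma partialSum_add_sum_Icc {i j : Fin N} (hij : i ≤ j) :
    partialSum lam i + ∑ k ∈ Finset.Icc i j, (lam k + 1) = partialSum lam (j + 1) := by
  have h : ∑ k ∈ Finset.Icc i j, (lam k + 1) =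
      ∑ k ∈ Finset.Ico (i : ℕ) (j + 1), (periodicExt lam k + 1) := by
    rw [show Finset.Ico (i : ℕ) (j + 1) = Finset.Icc (i : ℕ) j from by
      ext; simp, ← Fin.map_valEmbedding_Icc, Finset.sum_map]
    simp only [Fin.valEmbedding_apply, periodicExt_val]
  have hle : (i : ℕ) ≤ j + 1 := by have : (i : ℕ) ≤ j := hij; omega
  rw [h, partialSum, partialSum, Finset.sum_range_add_sum_Ico _ hle]

lemma admissible_iff_partialSum : Admissible N lam ↔ partialSum lam N = 2 * N ∧
    ∀ i j, i < j → j ≤ N → partialSum lam j ≠ partialSum lam i + N := by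
  rw [Admissible, sum_univ_eq_partialSum]
  refine and_congr_right fun _ => ⟨fun h i j hij hj he => ?_, fun h i j hij he => ?_⟩
  · obtain ⟨j, rfl⟩ := Nat.exists_eq_add_of_lt (Nat.zero_lt_of_lt hij)
    have hle : (⟨i, by omega⟩ : Fin N) ≤ ⟨0 + j, by omega⟩ := by
      rw [Fin.mk_le_mk]; omega
    have := partialSum_add_sum_Icc lam hle
    exact h _ _ hle (by simp only at this; omega)
  · have := partialSum_add_sum_Icc lam hij
    exact h i (j + 1) (Nat.lt_succ_of_le hij) j.isLt (by omega)

lemma eq_of_partialSum_eq {lam mu : Fin N → ℕ}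
    (h : ∀ n ≤ N, partialSum lam n = partialSum mu n) : lam = mu := by
  ext i
  have h₁ := h i i.isLt.le
  have h₂ := h (i + 1) i.isLt
  rw [partialSum_succ, partialSum_succ, periodicExt_val, periodicExt_val] at h₂
  omega

/-- The set of partial sums of the first fewer than `N` parts. -/
def partialSums : Finset ℕ := (Finset.range N).image (partialSum lam)

lemma mem_partialSums {x : ℕ} : x ∈ partialSums lam ↔ ∃ i < N, partialSum lam i = x := by
  simp [partialSums]

lemma card_partialSums : (partialSums lam).card = N := by
  rw [partialSums, Finset.card_image_of_injective _ (partialSum_strictMono lam).injective,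
    Finset.card_range]

lemma coe_partialSums :
    (partialSums lam : Set ℕ) = Set.range fun i : Fin N => partialSum lam i := by
  ext x
  simp only [Finset.mem_coe, mem_partialSums, Set.mem_range]
  exact ⟨fun ⟨i, hi, h⟩ => ⟨⟨i, hi⟩, h⟩, fun ⟨i, h⟩ => ⟨i, i.isLt, h⟩⟩

lemma eq_of_partialSums_eq {lam mu : Fin N → ℕ} (hN : partialSum lam N = partialSum mu N)
    (h : partialSums lam = partialSums mu) : lam = mu := by
  have hmono (nu : Fin N → ℕ) : StrictMono fun i : Fin N => partialSum nu i :=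
    fun _ _ hij => partialSum_strictMono nu hij
  have hfun := (StrictMono.range_inj (hmono lam) (hmono mu)).1 <| by
    rw [← coe_partialSums, ← coe_partialSums, h]
  refine eq_of_partialSum_eq fun n hn => ?_
  rcases hn.lt_or_eq with hn | rfl
  · exact congrFun hfun ⟨n, hn⟩
  · exact hN

variable {lam}

lemma Admissible.partialSum_self (h : Admissible N lam) : partialSum lam N = 2 * N :=
  ((admissible_iff_partialSum lam).1 h).1

lemma Admissible.lt_of_mem_partialSums (h : Admissible N lam) {x : ℕ}
    (hx : x ∈ partialSums lam) : x < 2 * N := by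
  obtain ⟨i, hi, rfl⟩ := (mem_partialSums lam).1 hx
  exact h.partialSum_self ▸ partialSum_strictMono lam hi

lemma Admissible.add_notMem_partialSums (h : Admissible N lam) {x : ℕ}
    (hx : x ∈ partialSums lam) : x + N ∉ partialSums lam := by
  intro hxN
  obtain ⟨i, hi, rfl⟩ := (mem_partialSums lam).1 hx
  obtain ⟨j, hj, hij⟩ := (mem_partialSums lam).1 hxN
  refine ((admissible_iff_partialSum lam).1 h).2 i j ?_ hj.le hij
  have := NeZero.pos N
  exact (partialSum_strictMono lam).lt_iff_lt.1 (by omega)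

lemma zero_mem_partialSums : 0 ∈ partialSums lam :=
  (mem_partialSums lam).2 ⟨0, NeZero.pos N, partialSum_zero lam⟩

lemma Admissible.add_mem_partialSums_iff (h : Admissible N lam) {x : ℕ} (hx : x < N) :
    x + N ∈ partialSums lam ↔ x ∉ partialSums lam := by
  refine ⟨fun h₁ h₂ => h.add_notMem_partialSums h₂ h₁, fun hn => ?_⟩
  have hmaps : Set.MapsTo (· % N) (partialSums lam : Set ℕ) (Finset.range N : Set ℕ) :=
    fun y _ => by simpa using Nat.mod_lt y (NeZero.pos N)
  have hinj : Set.InjOn (· % N) (partialSums lam : Set ℕ) := by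
    have key : ∀ y ∈ partialSums lam, ∀ z ∈ partialSums lam, y % N = z % N → y ≤ z → y = z := by
      intro y hy z hz hyz hle
      obtain ⟨c, hc⟩ := (Nat.modEq_iff_dvd' hle).1 hyz
      have hz2 := h.lt_of_mem_partialSums hz
      have hc2 : c < 2 := by
        by_contra! hc2
        have := Nat.mul_le_mul_left N hc2
        omega
      interval_cases c
      · omega
      · obtain rfl : z = y + N := by omega
        exact absurd hz (h.add_notMem_partialSums hy)
    intro y hy z hz hyz
    rcases le_total y z with hle | hle
    · exact key y hy z hz hyz hle
    · exact (key z hz y hy hyz.symm hle).symm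
  obtain ⟨y, hy, hyx⟩ := Finset.surjOn_of_injOn_of_card_le _ hmaps hinj
    (by rw [card_partialSums, Finset.card_range]) (by simpa using hx : x ∈ (Finset.range N : Set ℕ))
  have hy2 := h.lt_of_mem_partialSums hy
  simp only at hyx
  rcases lt_or_ge y N with hyN | hyN
  · rw [Nat.mod_eq_of_lt hyN] at hyx
    exact absurd (hyx ▸ hy) hn
  · rw [Nat.mod_eq_sub_mod hyN, Nat.mod_eq_of_lt (by omega)] at hyx
    rwa [show x + N = y by omega]

lemma Admissible.eq_of_partialSums_inter_eq {mu : Fin N → ℕ} (hl : Admissible N lam)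
    (hm : Admissible N mu) (h : Finset.Ico 1 N ∩ partialSums lam =
      Finset.Ico 1 N ∩ partialSums mu) : lam = mu := by
  refine eq_of_partialSums_eq (hl.partialSum_self.trans hm.partialSum_self.symm) ?_
  have hlow : ∀ x < N, x ∈ partialSums lam ↔ x ∈ partialSums mu := by
    intro x hx
    rcases Nat.eq_zero_or_pos x with rfl | hx0
    · simp [zero_mem_partialSums]
    · simpa [hx, Nat.one_le_iff_ne_zero.2 hx0.ne'] using Finset.ext_iff.1 h x
  ext x
  rcases lt_or_ge x N with hx | hx
  · exact hlow x hx
  · obtain ⟨y, rfl⟩ := Nat.exists_eq_add_of_le' hx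
    rcases lt_or_ge y N with hy | hy
    · rw [hl.add_mem_partialSums_iff hy, hm.add_mem_partialSums_iff hy, hlow y hy]
    · refine iff_of_false (fun hc => ?_) fun hc => ?_
      · have := hl.lt_of_mem_partialSums hc
        omega
      · have := hm.lt_of_mem_partialSums hc
        omega

lemma exists_partialSum_eq (q : ℕ → ℕ) (h0 : q 0 = 0) (hq : ∀ n < N, q n < q (n + 1)) :
    ∃ mu : Fin N → ℕ, ∀ n ≤ N, partialSum mu n = q n := by
  refine ⟨fun i => q (i + 1) - q i - 1, fun n => ?_⟩
  induction n with
  | zero => simp [partialSum_zero, h0]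
  | succ n ih =>
    intro hn
    rw [partialSum_succ, ih (by omega), ← Fin.val_mk (show n < N from hn), periodicExt_val]
    have := hq n hn
    simp only
    omega

lemma exists_partialSums_eq {S : Finset ℕ} {M : ℕ} (hS : S.card = N) (h0 : 0 ∈ S)
    (hM : ∀ x ∈ S, x < M) : ∃ mu : Fin N → ℕ, partialSum mu N = M ∧ partialSums mu = S := by
  let e := S.orderEmbOfFin hS
  have hrange : ∀ x, x ∈ S ↔ ∃ i, e i = x := fun x => by
    rw [← Finset.mem_coe, ← Finset.range_orderEmbOfFin S hS, Set.mem_range]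
  obtain ⟨mu, hmu⟩ := exists_partialSum_eq (N := N)
    (fun n => if h : n < N then e ⟨n, h⟩ else M) (by
      obtain ⟨i, hi⟩ := (hrange 0).1 h0
      have hle : e ⟨0, NeZero.pos N⟩ ≤ e i := e.monotone (Nat.zero_le _)
      simp only [NeZero.pos N, dif_pos]
      omega) (by
      intro n hn
      simp only [hn, dif_pos]
      split_ifs with hn'
      · exact e.strictMono (Nat.lt_succ_self n)
      · exact hM _ ((hrange _).2 ⟨_, rfl⟩))
  refine ⟨mu, by simp [hmu N le_rfl], ?_⟩
  ext x
  rw [mem_partialSums, hrange]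
  constructor
  · rintro ⟨i, hi, hx⟩
    exact ⟨⟨i, hi⟩, by simpa [hmu i hi.le, hi] using hx⟩
  · rintro ⟨i, hx⟩
    exact ⟨i, i.isLt, by simpa [hmu i i.isLt.le] using hx⟩

lemma exists_admissible_partialSums_inter_eq {T : Finset ℕ} (hT : T ⊆ Finset.Ico 1 N) :
    ∃ mu : Fin N → ℕ, Admissible N mu ∧ Finset.Ico 1 N ∩ partialSums mu = T := by
  have hN := NeZero.pos N
  have hT' : ∀ x ∈ T, 1 ≤ x ∧ x < N := fun x hx => Finset.mem_Ico.1 (hT hx)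
  let U := (Finset.Ico 1 N \ T).map (addRightEmbedding N)
  have hU : ∀ x, x ∈ U ↔ ∃ y, (1 ≤ y ∧ y < N) ∧ y ∉ T ∧ y + N = x := fun x => by
    simp [U, and_assoc]
  have hTU : Disjoint T U := by
    rw [Finset.disjoint_left]
    intro x hx hxU
    obtain ⟨y, -, -, rfl⟩ := (hU x).1 hxU
    have := hT' _ hx
    omega
  have h0 : 0 ∉ T ∪ U := by
    rw [Finset.mem_union, hU]
    rintro (h | ⟨y, -, -, h⟩)
    · exact absurd (hT' 0 h).1 (by omega)
    · omega
  have hS : ∀ x, x ∈ insert 0 (T ∪ U) ↔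
      x = 0 ∨ x ∈ T ∨ ∃ y, (1 ≤ y ∧ y < N) ∧ y ∉ T ∧ y + N = x := fun x => by
    rw [Finset.mem_insert, Finset.mem_union, hU]
  have hcard : (insert 0 (T ∪ U)).card = N := by
    rw [Finset.card_insert_of_notMem h0, Finset.card_union_of_disjoint hTU, Finset.card_map,
      Finset.card_sdiff_of_subset hT, Nat.card_Ico]
    have := Finset.card_le_card hT
    rw [Nat.card_Ico] at this
    omega
  obtain ⟨mu, hmuN, hmuS⟩ := exists_partialSums_eq (M := 2 * N) hcard
    (Finset.mem_insert_self _ _) (by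
      intro x hx
      rcases (hS x).1 hx with rfl | hx | ⟨y, hy, -, rfl⟩
      · omega
      · have := hT' x hx
        omega
      · omega)
  have hmem : ∀ i < N, partialSum mu i ∈ insert 0 (T ∪ U) := fun i hi =>
    hmuS ▸ (mem_partialSums mu).2 ⟨i, hi, rfl⟩
  have hNS : N ∉ insert 0 (T ∪ U) := by
    rw [hS]
    rintro (h | h | ⟨y, hy, -, h⟩)
    · omega
    · exact absurd (hT' _ h).2 (lt_irrefl _)
    · omega
  have hadd : ∀ x ∈ insert 0 (T ∪ U), x + N ∉ insert 0 (T ∪ U) := by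
    intro x hx hxN
    rcases (hS _).1 hxN with h | h | ⟨y, hy, hyT, h⟩
    · omega
    · have := hT' _ h
      omega
    · obtain rfl : y = x := by omega
      rcases (hS _).1 hx with h | h | ⟨z, hz, -, h⟩
      · omega
      · exact hyT h
      · omega
  refine ⟨mu, (admissible_iff_partialSum mu).2 ⟨hmuN, fun i j hij hj he => ?_⟩, ?_⟩
  · have hi := hmem i (by omega)
    rcases hj.lt_or_eq with hj | rfl
    · exact hadd _ hi (he ▸ hmem j hj)
    · exact hNS ((show partialSum mu i = j by omega) ▸ hi)
  · ext x
    rw [hmuS, Finset.mem_inter, Finset.mem_Ico, hS]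
    constructor
    · rintro ⟨hx, h | h | ⟨y, hy, -, h⟩⟩
      · omega
      · exact h
      · omega
    · exact fun hx => ⟨hT' x hx, Or.inr (Or.inl hx)⟩

variable (N) in
/-- For every `N ≥ 1`, there are `2 ^ (N - 1)` admissible `N`-tuples. -/
theorem card_admissible : Nat.card {lam : Fin N → ℕ // Admissible N lam} = 2 ^ (N - 1) := by
  have hbij : Function.Bijective fun lam : {lam : Fin N → ℕ // Admissible N lam} =>
      (⟨Finset.Ico 1 N ∩ partialSums lam.1, Finset.mem_powerset.2 Finset.inter_subset_left⟩ :
        {T // T ∈ (Finset.Ico 1 N).powerset}) := by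
    refine ⟨fun lam mu h => Subtype.ext ?_, fun ⟨T, hT⟩ => ?_⟩
    · exact lam.2.eq_of_partialSums_inter_eq mu.2 (congrArg Subtype.val h)
    · obtain ⟨mu, hmu, h⟩ := exists_admissible_partialSums_inter_eq (Finset.mem_powerset.1 hT)
      exact ⟨⟨mu, hmu⟩, Subtype.ext h⟩
  rw [Nat.card_eq_of_bijective _ hbij, Nat.card_eq_fintype_card, Fintype.card_coe,
    Finset.card_powerset, Nat.card_Ico]

lemma Admissible.not_periodic_half {m : ℕ} (hm : N = m + m) (h : Admissible N lam) :
    ¬ Function.Periodic (periodicExt lam) m := by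
  intro hp
  have hsum : partialSum lam N = partialSum lam m + partialSum lam m := by
    simp only [partialSum]
    rw [show Finset.range N = Finset.range (m + m) by rw [← hm], Finset.sum_range_add]
    congr 1
    refine Finset.sum_congr rfl fun k _ => ?_
    rw [add_comm m k, hp k]
  have hN := NeZero.pos N
  have := h.partialSum_self
  refine ((admissible_iff_partialSum lam).1 h).2 0 m (by omega) (by omega) ?_
  rw [partialSum_zero]
  omega

end

/-- A positive `d < 2 ^ a` has a multiple congruent to `2 ^ (a - 1)` modulo `2 ^ a`. -/
lemma exists_mul_eq_half_add {a d : ℕ} (hd : 1 ≤ d) (hda : d < 2 ^ (a + 1)) :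
    ∃ k m, k * d = 2 ^ a + m * 2 ^ (a + 1) := by
  obtain ⟨b, c, hc, rfl⟩ := Nat.exists_eq_two_pow_mul_odd (by omega : d ≠ 0)
  have hb : b ≤ a := by
    have hlt : 2 ^ b < 2 ^ (a + 1) := lt_of_le_of_lt (Nat.le_mul_of_pos_right _ hc.pos) hda
    have := (Nat.pow_lt_pow_iff_right (by norm_num)).1 hlt
    omega
  obtain ⟨m, rfl⟩ := hc
  refine ⟨2 ^ (a - b), m, ?_⟩
  rw [← mul_assoc, ← pow_add, Nat.sub_add_cancel hb]
  ring

theorem Admissible.aperiodic_of_pow_two {a : ℕ} {lam : Fin (2 ^ a) → ℕ}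
    (h : Admissible (2 ^ a) lam) : Aperiodic (2 ^ a) lam := by
  intro d hd hda hper
  by_contra hne
  have hlt := lt_of_le_of_ne hda hne
  obtain _ | a := a
  · simp at hlt
    omega
  obtain ⟨k, m, hkm⟩ := exists_mul_eq_half_add hd hlt
  refine h.not_periodic_half (m := 2 ^ a) (by ring) fun x => ?_
  have h₁ := hper.periodicExt_periodic.nsmul k x
  have h₂ := (periodicExt_periodic lam).nsmul m (x + 2 ^ a)
  rw [smul_eq_mul] at h₁ h₂
  rw [← h₂, add_assoc, ← hkm, h₁]

/-- if `N = 2^a`, every admissible `N`-tuple is aperiodic; consequently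
`A_N = 2^(N-1)`. -/
theorem aperiodic_of_pow_two (a : ℕ) :
    (∀ lam : Fin (2 ^ a) → ℕ, Admissible (2 ^ a) lam → Aperiodic (2 ^ a) lam) ∧
      numAperiodic (2 ^ a) = 2 ^ (2 ^ a - 1) := by
  refine ⟨fun _ h => h.aperiodic_of_pow_two, ?_⟩
  rw [numAperiodic, ← card_admissible]
  exact Nat.card_congr <| Equiv.subtypeEquivRight fun _ =>
    and_iff_left_of_imp Admissible.aperiodic_of_pow_two
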